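/- arXiv:2402.16305 — 4 statements merged into one kernel-verified Lean document; each statement's English description precedes it below -/
import Mathlib

section
/- Let L : ℝ^d → ℝ be measurable with sup_x |L(x)| ≤ R for some R ≥ 0, let σ > 0, and let g(x) = (σ^d (2π)^{d/2})^{-1} ∫_{ℝ^d} L(t) exp(-‖x-t‖²/(2σ²)) dt be its Gaussian smoothing. Then for every x ∈ ℝ^d and every unit vector v ∈ ℝ^d, the directional derivative satisfies |∇g(x)ᵀ v| ≤ √(2R²/(πσ²)). -/
open MeasureTheory
open scoped RealInnerProductSpace

lemma gs_integrable {d : ℕ} {b : ℝ} (hb : 0 < b) :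
    Integrable (fun u : EuclideanSpace ℝ (Fin d) => Real.exp (-b * ‖u‖ ^ 2)) := by
  by_contra h
  have h1 := integral_undef h
  rw [GaussianFourier.integral_rexp_neg_mul_sq_norm hb] at h1
  have : 0 < (Real.pi / b) ^ ((Module.finrank ℝ (EuclideanSpace ℝ (Fin d)) : ℝ) / 2) := by
    positivity
  exact this.ne' h1

lemma gs_integral_abs {b : ℝ} (hb : 0 < b) :
    ∫ y : ℝ, |y| * Real.exp (-b * y ^ 2) = 1 / b := by
  have h := integral_comp_abs (f := fun y => y * Real.exp (-b * y ^ 2))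
  simp only [sq_abs] at h
  rw [h]
  have h2 := integral_rpow_mul_exp_neg_mul_rpow (p := 2) (q := 1) (b := b)
    (by norm_num) (by norm_num) hb
  norm_num at h2
  simp only [neg_mul]
  rw [h2, Real.rpow_neg_one]
  field_simp

lemma gs_integral_inner {d : ℕ} {b : ℝ} (hb : 0 < b) (v : EuclideanSpace ℝ (Fin d))
    (hv : ‖v‖ = 1) :
    ∫ u : EuclideanSpace ℝ (Fin d), |⟪u, v⟫| * Real.exp (-b * ‖u‖ ^ 2)
      = 1 / b * Real.sqrt (Real.pi / b) ^ (d - 1) := by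
  have hd : 0 < d := by
    rcases Nat.eq_zero_or_pos d with h | h
    · subst h
      have : v = 0 := Subsingleton.elim _ _
      simp [this] at hv
    · exact h
  let i0 : Fin d := ⟨0, hd⟩
  obtain ⟨B, hB⟩ := Orthonormal.exists_orthonormalBasis_extension_of_card_eq (𝕜 := ℝ)
    (E := EuclideanSpace ℝ (Fin d)) (ι := Fin d) (by simp) (v := fun _ => v) (s := {i0}) (by
      constructor
      · intro i; simpa using hv
      · intro i j hij
        exact absurd (Subsingleton.elim i j) hij)
  have hB0 : B i0 = v := hB i0 rfl
  have e1 := B.measurePreserving_repr_symm.integral_comp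
    B.repr.symm.toHomeomorph.measurableEmbedding
    (fun u => |⟪u, v⟫| * Real.exp (-b * ‖u‖ ^ 2))
  have e2 := (PiLp.volume_preserving_toLp (Fin d)).integral_comp
    (MeasurableEquiv.toLp 2 (Fin d → ℝ)).measurableEmbedding
    (fun w => |⟪B.repr.symm w, v⟫| * Real.exp (-b * ‖B.repr.symm w‖ ^ 2))
  rw [← e1, ← e2]
  have e3 : ∀ y : Fin d → ℝ, |⟪B.repr.symm (WithLp.toLp 2 y), v⟫| *
      Real.exp (-b * ‖B.repr.symm (WithLp.toLp 2 y)‖ ^ 2) =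
      ∏ i, (fun (i : Fin d) (z : ℝ) => (if i = i0 then |z| else 1) * Real.exp (-b * z ^ 2)) i (y i) := by
    intro y
    rw [LinearIsometryEquiv.norm_map, EuclideanSpace.norm_sq_eq, ← hB0, real_inner_comm,
      ← B.repr_apply_apply, LinearIsometryEquiv.apply_symm_apply, Finset.prod_mul_distrib,
      ← Real.exp_sum, ← Finset.mul_sum]
    simp
  simp_rw [e3]
  rw [integral_fintype_prod_volume_eq_prod
    (fun (i : Fin d) (z : ℝ) => (if i = i0 then |z| else 1) * Real.exp (-b * z ^ 2))]
  rw [← Finset.mul_prod_erase _ _ (Finset.mem_univ i0)]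
  congr 1
  · simpa using gs_integral_abs hb
  · rw [Finset.prod_congr rfl (g := fun _ => Real.sqrt (Real.pi / b))]
    · simp
    · intro i hi
      have : i ≠ i0 := Finset.ne_of_mem_erase hi
      simp only [this, if_false, one_mul]
      exact integral_gaussian b

lemma gs_bound {d : ℕ} {b : ℝ} (hb : 0 < b) (u v a : EuclideanSpace ℝ (Fin d)) (s : ℝ)
    (hs : |s| ≤ 1) (hv : ‖v‖ = 1) (hu : u = a + s • v) :
    ‖u‖ * Real.exp (-b * ‖u‖ ^ 2) ≤
      (1 + 2 / b) * Real.exp (b / 2) * Real.exp (-(b / 4) * ‖a‖ ^ 2) := by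
  have h1 : ‖u‖ ≤ (1 + 2 / b) * Real.exp (b / 2 * ‖u‖ ^ 2) := by
    have := Real.add_one_le_exp (b / 2 * ‖u‖ ^ 2)
    have h3 : (1 + 2 / b) * (b / 2 * ‖u‖ ^ 2 + 1) ≤ (1 + 2 / b) * Real.exp (b / 2 * ‖u‖ ^ 2) := by
      gcongr
    refine le_trans ?_ h3
    have h4 : (1 + 2 / b) * (b / 2 * ‖u‖ ^ 2 + 1) = b / 2 * ‖u‖ ^ 2 + 1 + ‖u‖ ^ 2 + 2 / b := by
      field_simp
      ring
    rw [h4]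
    have : 0 < 2 / b := by positivity
    have : 0 ≤ b / 2 * ‖u‖ ^ 2 := by positivity
    nlinarith [sq_nonneg (‖u‖ - 1 / 2)]
  have h2 : ‖a‖ ≤ ‖u‖ + 1 := by
    have : a = u - s • v := by rw [hu]; simp
    rw [this]
    refine (norm_sub_le _ _).trans ?_
    rw [norm_smul, hv, Real.norm_eq_abs]
    linarith
  have h3 : ‖a‖ ^ 2 ≤ 2 * ‖u‖ ^ 2 + 2 := by
    nlinarith [sq_nonneg (‖u‖ - 1), norm_nonneg a, norm_nonneg u]
  calc ‖u‖ * Real.exp (-b * ‖u‖ ^ 2)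
      ≤ (1 + 2 / b) * Real.exp (b / 2 * ‖u‖ ^ 2) * Real.exp (-b * ‖u‖ ^ 2) := by gcongr
    _ = (1 + 2 / b) * Real.exp (-(b / 2) * ‖u‖ ^ 2) := by
        rw [mul_assoc, ← Real.exp_add]; ring_nf
    _ ≤ (1 + 2 / b) * Real.exp (b / 2 + -(b / 4) * ‖a‖ ^ 2) := by
        gcongr
        nlinarith
    _ = _ := by rw [Real.exp_add]; ring

lemma gs_deriv {d : ℕ} {b : ℝ} (hb : 0 < b)
    (L : EuclideanSpace ℝ (Fin d) → ℝ) (hLmeas : Measurable L)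
    (R : ℝ) (hR : 0 ≤ R) (hL : ∀ x, |L x| ≤ R) (x v : EuclideanSpace ℝ (Fin d)) (hv : ‖v‖ = 1) :
    Integrable (fun t => L t * (Real.exp (-b * ‖x - t‖ ^ 2) * (-b * (2 * ⟪x - t, v⟫)))) ∧
    HasDerivAt (fun s : ℝ => ∫ t, L t * Real.exp (-b * ‖x + s • v - t‖ ^ 2))
      (∫ t, L t * (Real.exp (-b * ‖x - t‖ ^ 2) * (-b * (2 * ⟪x - t, v⟫)))) 0 := by
  have key := hasDerivAt_integral_of_dominated_loc_of_deriv_le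
    (μ := (volume : Measure (EuclideanSpace ℝ (Fin d))))
    (F := fun (s : ℝ) t => L t * Real.exp (-b * ‖x + s • v - t‖ ^ 2))
    (F' := fun (s : ℝ) t => L t * (Real.exp (-b * ‖x + s • v - t‖ ^ 2) *
      (-b * (2 * ⟪x + s • v - t, v⟫))))
    (bound := fun t => R * (2 * b) * ((1 + 2 / b) * Real.exp (b / 2) *
      Real.exp (-(b / 4) * ‖x - t‖ ^ 2)))
    (x₀ := (0 : ℝ)) (s := Metric.ball 0 1) (Metric.ball_mem_nhds _ one_pos)
    ?_ ?_ ?_ ?_ ?_ ?_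
  · simpa using key
  · refine Filter.Eventually.of_forall fun s => ?_
    refine (hLmeas.mul ?_).aestronglyMeasurable
    exact (by fun_prop : Continuous fun t => Real.exp (-b * ‖x + s • v - t‖ ^ 2)).measurable
  · refine Integrable.bdd_mul (c := R) ?_ hLmeas.aestronglyMeasurable ?_
    · simpa using (gs_integrable hb).comp_sub_left x
    · exact Filter.Eventually.of_forall fun t => hL t
  · refine (hLmeas.mul ?_).aestronglyMeasurable
    exact (by fun_prop : Continuous fun t => Real.exp (-b * ‖x + (0 : ℝ) • v - t‖ ^ 2) *
      (-b * (2 * ⟪x + (0 : ℝ) • v - t, v⟫))).measurable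
  · refine Filter.Eventually.of_forall fun t s hs => ?_
    have hs' : |s| ≤ 1 := by
      have := Metric.mem_ball.1 hs
      rw [dist_zero_right, Real.norm_eq_abs] at this
      exact this.le
    have h := gs_bound hb (x + s • v - t) v (x - t) s hs' hv (by abel)
    have hi : |⟪x + s • v - t, v⟫| ≤ ‖x + s • v - t‖ := by
      simpa [hv] using abs_real_inner_le_norm (x + s • v - t) v
    rw [Real.norm_eq_abs, abs_mul, abs_mul, abs_mul, abs_mul, abs_neg, abs_of_pos hb, Real.abs_exp,
      abs_two]
    calc |L t| * (Real.exp (-b * ‖x + s • v - t‖ ^ 2) * (b * (2 * |⟪x + s • v - t, v⟫|)))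
        ≤ R * (Real.exp (-b * ‖x + s • v - t‖ ^ 2) * (b * (2 * ‖x + s • v - t‖))) := by
          gcongr
          exact hL t
      _ = R * (2 * b) * (‖x + s • v - t‖ * Real.exp (-b * ‖x + s • v - t‖ ^ 2)) := by ring
      _ ≤ _ := by gcongr
  · refine Integrable.const_mul (Integrable.const_mul ?_ _) _
    exact (gs_integrable (by positivity : 0 < b / 4)).comp_sub_left x
  · refine Filter.Eventually.of_forall fun t s hs => ?_
    have h0 : HasDerivAt (fun s : ℝ => x + s • v - t) v s := by
      simpa using (((hasDerivAt_id s).smul_const v).const_add x).sub_const t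
    exact ((h0.norm_sq.const_mul (-b)).exp).const_mul (L t)

lemma gs_const {d : ℕ} (hd : 0 < d) {σ R : ℝ} (hσ : 0 < σ) (hR : 0 ≤ R) :
    (σ ^ d * (2 * Real.pi) ^ ((d : ℝ) / 2))⁻¹ * (R * (2 * (1 / (2 * σ ^ 2))) *
      (1 / (1 / (2 * σ ^ 2)) * Real.sqrt (Real.pi / (1 / (2 * σ ^ 2))) ^ (d - 1))) =
      Real.sqrt (2 * R ^ 2 / (Real.pi * σ ^ 2)) := by
  have hpi := Real.pi_pos
  obtain ⟨n, rfl⟩ : ∃ n, d = n + 1 := ⟨d - 1, by omega⟩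
  have h1 : (2 * Real.pi) ^ (((n + 1 : ℕ) : ℝ) / 2) = Real.sqrt (2 * Real.pi) ^ (n + 1) := by
    rw [Real.sqrt_eq_rpow, ← Real.rpow_natCast, ← Real.rpow_mul (by positivity)]
    congr 1; ring
  have h2 : Real.sqrt (Real.pi / (1 / (2 * σ ^ 2))) = σ * Real.sqrt (2 * Real.pi) := by
    rw [Real.sqrt_eq_iff_mul_self_eq (by positivity) (by positivity)]
    have := Real.mul_self_sqrt (by positivity : 0 ≤ 2 * Real.pi)
    rw [mul_mul_mul_comm, this]
    field_simp
  rw [h1, h2]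
  symm
  have hs : 0 < Real.sqrt (2 * Real.pi) := by positivity
  have h3 : (σ ^ (n + 1) * Real.sqrt (2 * Real.pi) ^ (n + 1))⁻¹ * (R * (2 * (1 / (2 * σ ^ 2))) *
      (1 / (1 / (2 * σ ^ 2)) * (σ * Real.sqrt (2 * Real.pi)) ^ (n + 1 - 1))) =
      2 * R / (σ * Real.sqrt (2 * Real.pi)) := by
    rw [Nat.add_sub_cancel, mul_pow, pow_succ, pow_succ]
    field_simp
  rw [h3, Real.sqrt_eq_iff_mul_self_eq (by positivity) (by positivity)]
  have := Real.mul_self_sqrt (by positivity : 0 ≤ 2 * Real.pi)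
  rw [div_mul_div_comm, mul_mul_mul_comm σ, this]
  field_simp

/-- For `L : ℝ^d → ℝ` measurable and bounded by `R ≥ 0` and the
Gaussian smoothing `g(x) = (σ^d (2π)^{d/2})⁻¹ ∫ L(t) exp(-‖x-t‖²/(2σ²)) dt`,
the directional derivative in any unit direction `v` satisfies
`|∇g(x)ᵀ v| ≤ √(2R²/(πσ²))`. -/
theorem gaussian_smoothing_directional_derivative_bound {d : ℕ}
    (L : EuclideanSpace ℝ (Fin d) → ℝ) (hLmeas : Measurable L)
    (R : ℝ) (hR : 0 ≤ R) (hL : ∀ x, |L x| ≤ R) (σ : ℝ) (hσ : 0 < σ)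
    (g : EuclideanSpace ℝ (Fin d) → ℝ)
    (hg : ∀ x, g x = (σ ^ d * (2 * Real.pi) ^ ((d : ℝ) / 2))⁻¹ *
      ∫ t, L t * Real.exp (-‖x - t‖ ^ 2 / (2 * σ ^ 2)))
    (G : EuclideanSpace ℝ (Fin d) → EuclideanSpace ℝ (Fin d))
    (hG : ∀ x, HasGradientAt g (G x) x) :
    ∀ (x v : EuclideanSpace ℝ (Fin d)), ‖v‖ = 1 →
      |⟪G x, v⟫| ≤ Real.sqrt (2 * R ^ 2 / (Real.pi * σ ^ 2)) := by
  intro x v hv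
  have hd : 0 < d := by
    rcases Nat.eq_zero_or_pos d with h | h
    · subst h
      have : v = 0 := Subsingleton.elim _ _
      simp [this] at hv
    · exact h
  have hb : 0 < 1 / (2 * σ ^ 2) := by positivity
  obtain ⟨hint, hder⟩ := gs_deriv hb L hLmeas R hR hL x v hv
  have h1 := hder.const_mul (σ ^ d * (2 * Real.pi) ^ ((d : ℝ) / 2))⁻¹
  have hgs : (fun s : ℝ => g (x + s • v)) = fun s : ℝ =>
      (σ ^ d * (2 * Real.pi) ^ ((d : ℝ) / 2))⁻¹ *
        ∫ t, L t * Real.exp (-(1 / (2 * σ ^ 2)) * ‖x + s • v - t‖ ^ 2) := by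
    funext s
    rw [hg]
    congr 2
    funext t
    congr 2
    ring
  rw [← hgs] at h1
  have h0 : HasDerivAt (fun s : ℝ => x + s • v) v 0 := by
    simpa using ((hasDerivAt_id (0 : ℝ)).smul_const v).const_add x
  have hF : HasFDerivAt g ((InnerProductSpace.toDual ℝ _) (G x)) (x + (0 : ℝ) • v) := by
    simpa using (hG x).hasFDerivAt
  have h2 : HasDerivAt (fun s : ℝ => g (x + s • v)) ⟪G x, v⟫ 0 := by
    have h3 := hF.comp_hasDerivAt (0 : ℝ) h0
    rw [InnerProductSpace.toDual_apply_apply] at h3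
    exact h3
  rw [h2.unique h1, ← gs_const hd hσ hR, abs_mul,
    abs_of_pos (by positivity : 0 < (σ ^ d * (2 * Real.pi) ^ ((d : ℝ) / 2))⁻¹)]
  generalize 1 / (2 * σ ^ 2) = b at *
  gcongr
  rw [← gs_integral_inner hb v hv, ← integral_sub_left_eq_self
    (fun u => |⟪u, v⟫| * Real.exp (-b * ‖u‖ ^ 2)) _ x, ← integral_const_mul]
  have hint1 := (gs_deriv hb (fun _ => 1) measurable_const 1 zero_le_one (by simp) x v hv).1
  refine norm_integral_le_of_norm_le (f := fun t => L t * _) ((hint1.norm.const_mul R).congr ?_) ?_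
  · refine Filter.Eventually.of_forall fun t => ?_
    simp only [Real.norm_eq_abs, abs_mul, abs_neg, abs_of_pos hb, Real.abs_exp, abs_two, abs_one]
    ring
  · refine Filter.Eventually.of_forall fun t => ?_
    simp only [Real.norm_eq_abs, abs_mul, abs_neg, abs_of_pos hb, Real.abs_exp, abs_two]
    calc _ ≤ R * (Real.exp (-b * ‖x - t‖ ^ 2) * (b * (2 * |⟪x - t, v⟫|))) := by
          gcongr
          exact hL t
      _ = _ := by ring
end

section
/- Let L : ℝ^d → ℝ be measurable with sup_x |L(x)| ≤ R for some R ≥ 0, let σ > 0, and let g(x) = E_{ε∼N(0,σ²I_d)}[L(x+ε)] be its Gaussian smoothing. Then g is Lipschitz continuous with Lipschitz constant √(2R²/(πσ²)), i.e., |g(x) - g(x')| ≤ √(2R²/(πσ²)) · ‖x - x'‖ for all x, x' ∈ ℝ^d. -/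
open MeasureTheory

theorem gsl_one_dim (b : ℝ) (hb : 0 < b) (a : ℝ) (ha : 0 ≤ a) :
    ∫ y : ℝ, |Real.exp (-b * (a - y) ^ 2) - Real.exp (-b * y ^ 2)| ≤ 2 * a := by
  have hi : Integrable (fun y : ℝ => Real.exp (-b * y ^ 2)) := integrable_exp_neg_mul_sq hb
  have hi' : Integrable (fun y : ℝ => Real.exp (-b * (a - y) ^ 2)) := hi.comp_sub_left a
  have hD := hi'.sub hi
  have h0 : ∫ y : ℝ, (Real.exp (-b * (a - y) ^ 2) - Real.exp (-b * y ^ 2)) = 0 := by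
    rw [integral_sub hi' hi,
      integral_sub_left_eq_self (fun y : ℝ => Real.exp (-b * y ^ 2)) volume a, sub_self]
  have hsplit := intervalIntegral.integral_Iic_add_Ioi (b := a / 2) (μ := volume)
    hD.integrableOn hD.integrableOn
  simp only [Pi.sub_apply] at hsplit
  have hsplit2 := intervalIntegral.integral_Iic_add_Ioi (b := a / 2) (μ := volume)
    hD.abs.integrableOn hD.abs.integrableOn
  simp only [Pi.sub_apply] at hsplit2
  have h1 : ∫ y in Set.Iic (a / 2), |Real.exp (-b * (a - y) ^ 2) - Real.exp (-b * y ^ 2)|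
      = -∫ y in Set.Iic (a / 2), (Real.exp (-b * (a - y) ^ 2) - Real.exp (-b * y ^ 2)) := by
    rw [← integral_neg]
    refine setIntegral_congr_fun measurableSet_Iic fun y hy => ?_
    refine abs_of_nonpos (sub_nonpos.2 (Real.exp_le_exp.2 ?_))
    have hy' : y ≤ a / 2 := hy
    have : 0 ≤ b * (a * (a - 2 * y)) := mul_nonneg hb.le (mul_nonneg ha (by linarith))
    nlinarith
  have h2 : ∫ y in Set.Ioi (a / 2), |Real.exp (-b * (a - y) ^ 2) - Real.exp (-b * y ^ 2)|
      = ∫ y in Set.Ioi (a / 2), (Real.exp (-b * (a - y) ^ 2) - Real.exp (-b * y ^ 2)) := by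
    refine setIntegral_congr_fun measurableSet_Ioi fun y hy => ?_
    refine abs_of_nonneg (sub_nonneg.2 (Real.exp_le_exp.2 ?_))
    have hy' : a / 2 < y := hy
    have : 0 ≤ b * (a * (2 * y - a)) := mul_nonneg hb.le (mul_nonneg ha (by linarith))
    nlinarith
  have h3 : ∫ y in Set.Iic (a / 2), Real.exp (-b * (a - y) ^ 2)
      = ∫ y in Set.Iic (-(a / 2)), Real.exp (-b * y ^ 2) := by
    rw [← integral_indicator measurableSet_Iic, ← integral_indicator measurableSet_Iic,
      ← integral_sub_right_eq_self
        ((Set.Iic (-(a / 2))).indicator fun y : ℝ => Real.exp (-b * y ^ 2)) a]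
    congr 1
    ext y
    simp only [Set.indicator, Set.mem_Iic]
    have : y ≤ a / 2 ↔ y - a ≤ -(a / 2) := by constructor <;> intro h <;> linarith
    simp only [this]
    congr 3
    ring
  have h4 : ∫ y in Set.Iic (a / 2), (Real.exp (-b * (a - y) ^ 2) - Real.exp (-b * y ^ 2))
      = - ∫ y in (-(a / 2))..(a / 2), Real.exp (-b * y ^ 2) := by
    rw [integral_sub hi'.integrableOn hi.integrableOn, h3,
      ← intervalIntegral.integral_Iic_sub_Iic hi.integrableOn hi.integrableOn]
    ring
  have h5 : ∫ y in (-(a / 2))..(a / 2), Real.exp (-b * y ^ 2) ≤ a := by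
    have := intervalIntegral.integral_mono_on (μ := volume) (a := -(a / 2)) (b := a / 2)
      (f := fun y : ℝ => Real.exp (-b * y ^ 2)) (g := fun _ => (1 : ℝ)) (by linarith)
      hi.intervalIntegrable (by simp) (fun y _ => by
        rw [Real.exp_le_one_iff]; nlinarith [mul_nonneg hb.le (sq_nonneg y)])
    simp at this
    simpa using this
  linarith

theorem gsl_integrable {d : ℕ} (b : ℝ) (hb : 0 < b) (x : EuclideanSpace ℝ (Fin d)) :
    Integrable (fun t : EuclideanSpace ℝ (Fin d) => Real.exp (-b * ‖x - t‖ ^ 2)) := by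
  have h := GaussianFourier.integrable_cexp_neg_mul_sq_norm_add (V := EuclideanSpace ℝ (Fin d))
    (b := (b : ℂ)) (by simpa using hb) 0 0
  have h2 := h.norm
  have h3 : Integrable (fun t : EuclideanSpace ℝ (Fin d) => Real.exp (-b * ‖t‖ ^ 2)) := by
    refine h2.congr (Filter.Eventually.of_forall fun t => ?_)
    simp only [Complex.norm_exp]
    congr 1
    simp [← Complex.ofReal_pow]
  exact h3.comp_sub_left x

theorem gsl_multi {d : ℕ} (b : ℝ) (hb : 0 < b) (x x' : EuclideanSpace ℝ (Fin d))
    (hx : x ≠ x') :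
    ∫ t : EuclideanSpace ℝ (Fin d),
      |Real.exp (-b * ‖x - t‖ ^ 2) - Real.exp (-b * ‖x' - t‖ ^ 2)|
      ≤ 2 * ‖x - x'‖ * (Real.sqrt (Real.pi / b)) ^ (d - 1) := by
  obtain ⟨i0⟩ : Nonempty (Fin d) := by
    by_contra h
    rw [not_nonempty_iff] at h
    exact hx (Subsingleton.elim _ _)
  set a := ‖x - x'‖ with ha
  have ha0 : 0 < a := norm_pos_iff.2 (sub_ne_zero.2 hx)
  obtain ⟨B, hB⟩ := Orthonormal.exists_orthonormalBasis_extension_of_card_eq (𝕜 := ℝ)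
    (E := EuclideanSpace ℝ (Fin d)) (ι := Fin d) (by simp)
    (v := fun _ => a⁻¹ • (x - x')) (s := {i0}) (by
      constructor
      · intro i
        simp only [Set.domRestrict_apply, norm_smul, norm_inv, Real.norm_eq_abs, abs_of_pos ha0]
        rw [← ha]; field_simp
      · intro i j hij
        exact absurd (Subsingleton.elim i j) hij)
  have hB0 := hB i0 rfl
  have hxx : x - x' = a • B i0 := by
    rw [hB0, smul_smul, mul_inv_cancel₀ ha0.ne', one_smul]
  rw [← integral_add_left_eq_self _ x']
  let f : Fin d → ℝ → ℝ := fun i y => if i = i0 then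
    |Real.exp (-b * (a - y) ^ 2) - Real.exp (-b * y ^ 2)| else Real.exp (-b * y ^ 2)
  have key : ∀ t : EuclideanSpace ℝ (Fin d),
      |Real.exp (-b * ‖x - (x' + t)‖ ^ 2) - Real.exp (-b * ‖x' - (x' + t)‖ ^ 2)|
        = ∏ i, f i (B.repr t i) := by
    intro t
    have e1 : ‖x - (x' + t)‖ ^ 2 = (a - B.repr t i0) ^ 2
        + ∑ i ∈ Finset.univ.erase i0, (B.repr t i) ^ 2 := by
      rw [← sub_sub, hxx, ← B.repr.norm_map, EuclideanSpace.norm_sq_eq,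
        ← Finset.add_sum_erase _ _ (Finset.mem_univ i0)]
      congr 1
      · simp
      · refine Finset.sum_congr rfl fun i hi => ?_
        have : i ≠ i0 := Finset.ne_of_mem_erase hi
        simp [this]
    have e2 : ‖x' - (x' + t)‖ ^ 2 = (B.repr t i0) ^ 2
        + ∑ i ∈ Finset.univ.erase i0, (B.repr t i) ^ 2 := by
      rw [show x' - (x' + t) = -t by abel, norm_neg, ← B.repr.norm_map, EuclideanSpace.norm_sq_eq,
        ← Finset.add_sum_erase _ _ (Finset.mem_univ i0)]
      simp
    rw [e1, e2, mul_add, mul_add, Real.exp_add, Real.exp_add, ← sub_mul, abs_mul, Real.abs_exp,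
      Finset.mul_sum, Real.exp_sum, ← Finset.mul_prod_erase _ _ (Finset.mem_univ i0)]
    congr 1
    · simp [f]
    · refine Finset.prod_congr rfl fun i hi => ?_
      have : i ≠ i0 := Finset.ne_of_mem_erase hi
      simp [f, this]
  simp_rw [key]
  have m1 := B.repr.measurePreserving.integral_comp
    B.repr.toHomeomorph.measurableEmbedding
    (fun y : EuclideanSpace ℝ (Fin d) => ∏ i, f i (y i))
  have m2 := (PiLp.volume_preserving_toLp (Fin d)).integral_comp
    (MeasurableEquiv.toLp 2 _).measurableEmbedding
    (fun y : EuclideanSpace ℝ (Fin d) => ∏ i, f i (y i))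
  refine (m1.trans m2.symm).trans_le ?_
  rw [integral_fintype_prod_volume_eq_prod (f := f),
    ← Finset.mul_prod_erase _ _ (Finset.mem_univ i0)]
  have p : ∏ i ∈ Finset.univ.erase i0, ∫ y, f i y = (Real.sqrt (Real.pi / b)) ^ (d - 1) := by
    rw [Finset.prod_congr rfl (g := fun _ => Real.sqrt (Real.pi / b))]
    · simp
    · intro i hi
      have : i ≠ i0 := Finset.ne_of_mem_erase hi
      simp only [f, this, if_false]
      exact integral_gaussian b
  rw [p]
  gcongr
  simpa [f] using gsl_one_dim b hb a ha0.le

/-- For `L : ℝ^d → ℝ` measurable and bounded by `R ≥ 0` and `σ > 0`,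
the Gaussian smoothing `g(x) = (σ^d (2π)^{d/2})⁻¹ ∫ L(t) exp(-‖x-t‖²/(2σ²)) dt`
is Lipschitz with constant `√(2R²/(πσ²))`:
`|g(x) - g(x')| ≤ √(2R²/(πσ²)) ‖x - x'‖` for all `x, x'`. -/
theorem gaussian_smoothing_lipschitz {d : ℕ}
    (L : EuclideanSpace ℝ (Fin d) → ℝ) (hLmeas : Measurable L)
    (R : ℝ) (hR : 0 ≤ R) (hL : ∀ x, |L x| ≤ R) (σ : ℝ) (hσ : 0 < σ)
    (g : EuclideanSpace ℝ (Fin d) → ℝ)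
    (hg : ∀ x, g x = (σ ^ d * (2 * Real.pi) ^ ((d : ℝ) / 2))⁻¹ *
      ∫ t, L t * Real.exp (-‖x - t‖ ^ 2 / (2 * σ ^ 2))) :
    ∀ x x' : EuclideanSpace ℝ (Fin d),
      |g x - g x'| ≤ Real.sqrt (2 * R ^ 2 / (Real.pi * σ ^ 2)) * ‖x - x'‖ := by
  intro x x'
  by_cases hx : x = x'
  · simp [hx]
  have hd : d - 1 + 1 = d := by
    rcases d with _ | d
    · exact absurd (Subsingleton.elim x x') hx
    · simp
  have hpi := Real.pi_pos
  set b : ℝ := (2 * σ ^ 2)⁻¹ with hbdef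
  have hb : 0 < b := by positivity
  have hexp : ∀ z t : EuclideanSpace ℝ (Fin d),
      Real.exp (-‖z - t‖ ^ 2 / (2 * σ ^ 2)) = Real.exp (-b * ‖z - t‖ ^ 2) := by
    intro z t; congr 1; rw [hbdef]; field_simp
  have hLint : ∀ z, Integrable (fun t => L t * Real.exp (-b * ‖z - t‖ ^ 2)) := fun z =>
    (gsl_integrable b hb z).bdd_mul hLmeas.aestronglyMeasurable
      (Filter.Eventually.of_forall fun t => by simpa using hL t)
  simp only [hexp] at hg
  set s := Real.sqrt (2 * Real.pi) with hs
  have hs0 : 0 < s := by positivity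
  have hs2 : s ^ 2 = 2 * Real.pi := Real.sq_sqrt (by positivity)
  have hpow : (2 * Real.pi) ^ ((d : ℝ) / 2) = s ^ d := by
    rw [hs, Real.sqrt_eq_rpow, ← Real.rpow_natCast, ← Real.rpow_mul (by positivity)]
    congr 1; ring
  have hsb : Real.sqrt (Real.pi / b) = σ * s := by
    rw [Real.sqrt_eq_iff_mul_self_eq (by positivity) (by positivity)]
    rw [hbdef]
    field_simp
    linear_combination -hs2
  have hC : Real.sqrt (2 * R ^ 2 / (Real.pi * σ ^ 2)) = 2 * R / (σ * s) := by
    rw [Real.sqrt_eq_iff_mul_self_eq (by positivity) (by positivity)]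
    field_simp
    rw [hs2]; ring
  have hbound : |(∫ t, L t * Real.exp (-b * ‖x - t‖ ^ 2))
      - ∫ t, L t * Real.exp (-b * ‖x' - t‖ ^ 2)|
      ≤ R * (2 * ‖x - x'‖ * (σ * s) ^ (d - 1)) := by
    rw [← integral_sub (hLint x) (hLint x')]
    refine (abs_integral_le_integral_abs).trans ?_
    rw [← hsb]
    refine le_trans ?_ (mul_le_mul_of_nonneg_left (gsl_multi b hb x x' hx) hR)
    rw [← integral_const_mul]
    refine integral_mono ((hLint x).sub (hLint x')).abs
      (((gsl_integrable b hb x).sub (gsl_integrable b hb x')).abs.const_mul R) fun t => ?_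
    simp only [← mul_sub, abs_mul]
    exact mul_le_mul_of_nonneg_right (hL t) (abs_nonneg _)
  rw [hg, hg, ← mul_sub, abs_mul, hpow, hC, ← mul_pow, abs_of_pos (by positivity)]
  refine (mul_le_mul_of_nonneg_left hbound (by positivity)).trans_eq ?_
  have : (σ * s) ^ d = (σ * s) ^ (d - 1) * (σ * s) := by rw [← pow_succ, hd]
  rw [this]
  field_simp
end

section
/- Let f : ℝ^d → ℝ be twice continuously differentiable with μ‖v‖² ≤ vᵀ ∂²f(x) v ≤ L‖v‖² for all x, v ∈ ℝ^d, where 0 < μ ≤ L. Let ε be a random vector with distribution P on ℝ^d whose support is all of ℝ^d (every nonempty open set has positive P-measure), let g(x) = E_ε[f(x+ε)], and assume ∂²g(x) = E_ε[∂²f(x+ε)] for all x. Suppose additionally there exist x₀ ∈ ℝ^d and c₁ > 0 such that vᵀ ∂²f(x₀) v ≥ (μ + c₁)‖v‖² for all v. Then for every x ∈ ℝ^d there exists μ₁ > μ such that vᵀ ∂²g(x) v ≥ μ₁‖v‖² for all v ∈ ℝ^d. -/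
open MeasureTheory

/-- Near a point, a continuous family of bilinear forms is close to its value there. -/
lemma exists_open_quadratic_close {E : Type*} [NormedAddCommGroup E] [NormedSpace ℝ E]
    (H : E → E →L[ℝ] E →L[ℝ] ℝ) (hH : Continuous H) (a : E) (c : ℝ) (hc : 0 < c) :
    ∃ U : Set E, IsOpen U ∧ a ∈ U ∧
      ∀ e ∈ U, ∀ v : E, H a v v - c * ‖v‖ ^ 2 ≤ H e v v := by
  refine ⟨H ⁻¹' Metric.ball (H a) c, Metric.isOpen_ball.preimage hH, by simpa using hc, ?_⟩
  intro e he v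
  have h2 : ‖H e - H a‖ < c := by
    have h0 : dist (H e) (H a) < c := he
    have h7 : dist (H e) (H a) = ‖H e - H a‖ := dist_eq_norm (H e) (H a)
    exact h7.symm.trans_lt h0
  have h1 := (H e - H a).le_opNorm₂ v v
  have h3 := (abs_le.mp ((Real.norm_eq_abs _).symm.trans_le h1)).1
  have h6 : (H e - H a) v v = H e v v - H a v v := rfl
  rw [h6] at h3
  have h5 := mul_le_mul_of_nonneg_right h2.le (sq_nonneg ‖v‖)
  nlinarith

/-- Under the assumptions of Proposition 2 (with `P` having full
support on `ℝ^d`), if additionally `vᵀ∂²f(x₀)v ≥ (μ+c₁)‖v‖²` at some point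
`x₀` for some `c₁ > 0`, then for every `x` there exists `μ₁ > μ` with
`vᵀ∂²g(x)v ≥ μ₁‖v‖²` for all `v`. -/
theorem smoothed_hessian_strict_lower_bound {d : ℕ}
    (f : EuclideanSpace ℝ (Fin d) → ℝ) (hf : ContDiff ℝ 2 f)
    (μ L : ℝ) (hμ : 0 < μ) (hμL : μ ≤ L)
    (hHess : ∀ x v : EuclideanSpace ℝ (Fin d),
      μ * ‖v‖ ^ 2 ≤ fderiv ℝ (fderiv ℝ f) x v v ∧
      fderiv ℝ (fderiv ℝ f) x v v ≤ L * ‖v‖ ^ 2)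
    (P : Measure (EuclideanSpace ℝ (Fin d))) [IsProbabilityMeasure P]
    (hsupp : ∀ U : Set (EuclideanSpace ℝ (Fin d)), IsOpen U → U.Nonempty → 0 < P U)
    (g : EuclideanSpace ℝ (Fin d) → ℝ)
    (hg : ∀ x, g x = ∫ e, f (x + e) ∂P)
    (hgHess : ∀ x v : EuclideanSpace ℝ (Fin d),
      fderiv ℝ (fderiv ℝ g) x v v = ∫ e, fderiv ℝ (fderiv ℝ f) (x + e) v v ∂P)
    (x₀ : EuclideanSpace ℝ (Fin d)) (c₁ : ℝ) (hc₁ : 0 < c₁)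
    (hx₀ : ∀ v : EuclideanSpace ℝ (Fin d),
      (μ + c₁) * ‖v‖ ^ 2 ≤ fderiv ℝ (fderiv ℝ f) x₀ v v) :
    ∀ x : EuclideanSpace ℝ (Fin d), ∃ μ₁ : ℝ, μ < μ₁ ∧
      ∀ v : EuclideanSpace ℝ (Fin d), μ₁ * ‖v‖ ^ 2 ≤ fderiv ℝ (fderiv ℝ g) x v v := by
  intro x
  have hcont : Continuous (fderiv ℝ (fderiv ℝ f)) :=
    (hf.fderiv_right (m := 1) (by norm_num)).continuous_fderiv (by norm_num)
  have hcx : Continuous fun e => fderiv ℝ (fderiv ℝ f) (x + e) :=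
    hcont.comp (continuous_const.add continuous_id)
  obtain ⟨U, hUo, hxU, hUb⟩ := exists_open_quadratic_close _ hcx (x₀ - x) (c₁ / 2) (by positivity)
  have hUn : U.Nonempty := ⟨_, hxU⟩
  have hP : 0 < P.real U :=
    ENNReal.toReal_pos (hsupp U hUo hUn).ne' (measure_ne_top P U)
  refine ⟨μ + c₁ / 2 * P.real U, by nlinarith [mul_pos hc₁ hP], fun v => ?_⟩
  rw [hgHess]
  have hcv : Continuous fun e => fderiv ℝ (fderiv ℝ f) (x + e) v v :=
    (hcx.clm_apply continuous_const).clm_apply continuous_const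
  have hint : Integrable (fun e => fderiv ℝ (fderiv ℝ f) (x + e) v v) P := by
    refine Integrable.of_bound hcv.aestronglyMeasurable (L * ‖v‖ ^ 2)
      (Filter.Eventually.of_forall fun e => ?_)
    have h := hHess (x + e) v
    rw [Real.norm_eq_abs, abs_of_nonneg (le_trans (by positivity) h.1)]
    exact h.2
  have hind : Integrable (U.indicator fun _ => c₁ / 2 * ‖v‖ ^ 2) P :=
    (integrable_const _).indicator hUo.measurableSet
  have hle : ∫ e, (μ * ‖v‖ ^ 2 + U.indicator (fun _ => c₁ / 2 * ‖v‖ ^ 2) e) ∂P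
      ≤ ∫ e, fderiv ℝ (fderiv ℝ f) (x + e) v v ∂P := by
    refine integral_mono ((integrable_const _).add hind) hint fun e => ?_
    by_cases he : e ∈ U
    · simp only [Set.indicator_of_mem he]
      have h1 := hUb e he v
      rw [add_sub_cancel] at h1
      have h4 := hx₀ v
      linarith
    · simp only [Set.indicator_of_notMem he, add_zero]
      exact (hHess (x + e) v).1
  rw [integral_add (integrable_const _) hind, integral_indicator_const _ hUo.measurableSet] at hle
  simp only [integral_const, smul_eq_mul, probReal_univ, one_mul] at hle
  calc _ = _ := by ring
    _ ≤ _ := hle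
end

section
/- Let f : ℝ^d → ℝ be twice continuously differentiable with μ‖v‖² ≤ vᵀ ∂²f(x) v ≤ L‖v‖² for all x, v ∈ ℝ^d, where 0 < μ ≤ L. Let ε be a random vector with distribution P on ℝ^d whose support is all of ℝ^d (every nonempty open set has positive P-measure), let g(x) = E_ε[f(x+ε)], and assume ∂²g(x) = E_ε[∂²f(x+ε)] for all x. Suppose additionally there exist x₁ ∈ ℝ^d and c₂ > 0 such that vᵀ ∂²f(x₁) v ≤ (L − c₂)‖v‖² for all v. Then for every x ∈ ℝ^d there exists L₁ < L such that vᵀ ∂²g(x) v ≤ L₁‖v‖² for all v ∈ ℝ^d. -/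
open MeasureTheory

/-- Under the assumptions of Proposition 2 (with `P` having full
support on `ℝ^d`), if additionally `vᵀ∂²f(x₁)v ≤ (L−c₂)‖v‖²` at some point
`x₁` for some `c₂ > 0`, then for every `x` there exists `L₁ < L` with
`vᵀ∂²g(x)v ≤ L₁‖v‖²` for all `v`. -/
theorem smoothed_hessian_strict_upper_bound {d : ℕ}
    (f : EuclideanSpace ℝ (Fin d) → ℝ) (hf : ContDiff ℝ 2 f)
    (μ L : ℝ) (hμ : 0 < μ) (hμL : μ ≤ L)
    (hHess : ∀ x v : EuclideanSpace ℝ (Fin d),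
      μ * ‖v‖ ^ 2 ≤ fderiv ℝ (fderiv ℝ f) x v v ∧
      fderiv ℝ (fderiv ℝ f) x v v ≤ L * ‖v‖ ^ 2)
    (P : Measure (EuclideanSpace ℝ (Fin d))) [IsProbabilityMeasure P]
    (hsupp : ∀ U : Set (EuclideanSpace ℝ (Fin d)), IsOpen U → U.Nonempty → 0 < P U)
    (g : EuclideanSpace ℝ (Fin d) → ℝ)
    (hg : ∀ x, g x = ∫ e, f (x + e) ∂P)
    (hgHess : ∀ x v : EuclideanSpace ℝ (Fin d),
      fderiv ℝ (fderiv ℝ g) x v v = ∫ e, fderiv ℝ (fderiv ℝ f) (x + e) v v ∂P)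
    (x₁ : EuclideanSpace ℝ (Fin d)) (c₂ : ℝ) (hc₂ : 0 < c₂)
    (hx₁ : ∀ v : EuclideanSpace ℝ (Fin d),
      fderiv ℝ (fderiv ℝ f) x₁ v v ≤ (L - c₂) * ‖v‖ ^ 2) :
    ∀ x : EuclideanSpace ℝ (Fin d), ∃ L₁ : ℝ, L₁ < L ∧
      ∀ v : EuclideanSpace ℝ (Fin d), fderiv ℝ (fderiv ℝ g) x v v ≤ L₁ * ‖v‖ ^ 2 := by
  intro x
  have hc : Continuous (fderiv ℝ (fderiv ℝ f)) :=
    (hf.fderiv_right (m := 1) (by norm_num)).continuous_fderiv (by norm_num)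
  have hcx : Continuous fun e => fderiv ℝ (fderiv ℝ f) (x + e) := by fun_prop
  set U : Set (EuclideanSpace ℝ (Fin d)) :=
    {e | ‖fderiv ℝ (fderiv ℝ f) (x + e) - fderiv ℝ (fderiv ℝ f) x₁‖ < c₂ / 2} with hU
  have hsub : Continuous fun e =>
      fderiv ℝ (fderiv ℝ f) (x + e) - fderiv ℝ (fderiv ℝ f) x₁ := hcx.sub continuous_const
  have hnorm : Continuous fun e =>
      ‖fderiv ℝ (fderiv ℝ f) (x + e) - fderiv ℝ (fderiv ℝ f) x₁‖ :=
    (continuous_norm (E := EuclideanSpace ℝ (Fin d) →L[ℝ] EuclideanSpace ℝ (Fin d) →L[ℝ] ℝ)).comp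
      hsub
  have hUo : IsOpen U := isOpen_lt hnorm continuous_const
  have hUn : U.Nonempty := by
    refine ⟨x₁ - x, ?_⟩
    change ‖fderiv ℝ (fderiv ℝ f) (x + (x₁ - x)) - fderiv ℝ (fderiv ℝ f) x₁‖ < c₂ / 2
    rw [add_sub_cancel, sub_self]
    exact (norm_zero (E := EuclideanSpace ℝ (Fin d) →L[ℝ] EuclideanSpace ℝ (Fin d) →L[ℝ] ℝ)).trans_lt (half_pos hc₂)
  have hPU : 0 < P.real U :=
    ENNReal.toReal_pos (hsupp U hUo hUn).ne' (measure_ne_top _ _)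
  refine ⟨L - c₂ / 2 * P.real U, by nlinarith [mul_pos hc₂ hPU], fun v => ?_⟩
  rw [hgHess]
  have hcv : Continuous fun e => fderiv ℝ (fderiv ℝ f) (x + e) v v := by fun_prop
  have hint : Integrable (fun e => fderiv ℝ (fderiv ℝ f) (x + e) v v) P := by
    refine Integrable.of_bound hcv.aestronglyMeasurable (L * ‖v‖ ^ 2)
      (Filter.Eventually.of_forall fun e => ?_)
    have h := hHess (x + e) v
    have h0 : 0 ≤ μ * ‖v‖ ^ 2 := by positivity
    rw [Real.norm_of_nonneg (h0.trans h.1)]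
    exact h.2
  have hind : Integrable (U.indicator fun _ => c₂ / 2 * ‖v‖ ^ 2) P :=
    (integrable_const _).indicator hUo.measurableSet
  have hle : ∀ e, fderiv ℝ (fderiv ℝ f) (x + e) v v ≤
      L * ‖v‖ ^ 2 - U.indicator (fun _ => c₂ / 2 * ‖v‖ ^ 2) e := by
    intro e
    by_cases he : e ∈ U
    · rw [Set.indicator_of_mem he]
      have h1 := ContinuousLinearMap.le_opNorm₂
        (fderiv ℝ (fderiv ℝ f) (x + e) - fderiv ℝ (fderiv ℝ f) x₁) v v
      have h2 : ‖fderiv ℝ (fderiv ℝ f) (x + e) - fderiv ℝ (fderiv ℝ f) x₁‖ < c₂ / 2 := he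
      have h3 := (Real.le_norm_self _).trans h1
      simp only [sub_apply] at h3
      have h4 := hx₁ v
      nlinarith [mul_le_mul_of_nonneg_right h2.le (sq_nonneg ‖v‖)]
    · rw [Set.indicator_of_notMem he, sub_zero]
      exact (hHess _ v).2
  calc ∫ e, fderiv ℝ (fderiv ℝ f) (x + e) v v ∂P
      ≤ ∫ e, (L * ‖v‖ ^ 2 - U.indicator (fun _ => c₂ / 2 * ‖v‖ ^ 2) e) ∂P :=
        integral_mono hint ((integrable_const _).sub hind) hle
    _ = L * ‖v‖ ^ 2 - P.real U * (c₂ / 2 * ‖v‖ ^ 2) := by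
        rw [integral_sub (integrable_const _) hind, integral_indicator_const _ hUo.measurableSet]
        simp
    _ = (L - c₂ / 2 * P.real U) * ‖v‖ ^ 2 := by ring
end
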